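/- Let n ≥ 2 and let c ∈ ℝ with c < 0. Then there exists no totally symmetric 3-tensor h : Fin n → Fin n → Fin n → ℝ satisfying the flat Ricci commutator relation with constant c all of whose slices H m are traceless (trace (H m) = 0 for all m). -/

import Mathlib

open Matrix BigOperators

/-- For `n ≥ 2` and `c < 0`, there is no totally symmetric 3-tensor
satisfying the flat Ricci commutator relation with constant `c` all of whose slices
are traceless. -/
theorem no_traceless_flat_ricci_of_neg
    (n : ℕ) (hn : 2 ≤ n) (c : ℝ) (hc : c < 0) :
    ¬ ∃ h : Fin n → Fin n → Fin n → ℝ,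
        (∀ i j k : Fin n, h i j k = h j i k) ∧
        (∀ i j k : Fin n, h i j k = h i k j) ∧
        (∀ i j k l : Fin n,
          ((Matrix.of fun a b => h i a b) * (Matrix.of fun a b => h j a b)
            - (Matrix.of fun a b => h j a b) * (Matrix.of fun a b => h i a b)) k l
            = (c / 4) * ((if i = l then (1:ℝ) else 0) * (if j = k then (1:ℝ) else 0)
                - (if i = k then (1:ℝ) else 0) * (if j = l then (1:ℝ) else 0))) ∧
        (∀ m : Fin n, (Matrix.of fun a b => h m a b).trace = 0) := by
  rintro ⟨h, hs₁, hs₂, hR, ht⟩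
  have hσ : ∑ i, ∑ j, ∑ m, (h i j m * h j m i - h j j m * h i m i)
      = ∑ i : Fin n, ∑ j : Fin n, ∑ m : Fin n, h i j m ^ 2 := by
    have htr : ∑ i, ∑ j, ∑ m, h j j m * h i m i = 0 := by
      refine Finset.sum_eq_zero fun i _ => ?_
      rw [Finset.sum_comm]
      refine Finset.sum_eq_zero fun m _ => ?_
      rw [← Finset.sum_mul]
      have hm : ∑ j, h j j m = 0 := by
        rw [← ht m]
        exact Finset.sum_congr rfl fun j _ => by
          rw [hs₂ j j m, hs₁ j m j]; rfl
      rw [hm, zero_mul]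
    simp only [Finset.sum_sub_distrib, htr, sub_zero]
    refine Finset.sum_congr rfl fun i _ => Finset.sum_congr rfl fun j _ =>
      Finset.sum_congr rfl fun m _ => ?_
    rw [hs₂ j m i, hs₁ j i m, sq]
  have hcontr : ∑ i, ∑ j, ∑ m, (h i j m * h j m i - h j j m * h i m i)
      = (c / 4) * (n * (n - 1)) := by
    have hentry : ∀ i j, ∑ m, (h i j m * h j m i - h j j m * h i m i)
        = (c / 4) * (1 - if i = j then 1 else 0) := by
      intro i j
      have hij := hR i j j i
      simp only [Matrix.sub_apply, Matrix.mul_apply, Matrix.of_apply] at hij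
      rw [Finset.sum_sub_distrib, hij]
      by_cases hd : i = j
      · simp [hd]
      · simp [hd]
    simp only [hentry, ← Finset.mul_sum, Finset.sum_sub_distrib, Finset.sum_const,
      Finset.sum_ite_eq, Finset.mem_univ, if_true, Finset.card_univ, Fintype.card_fin,
      nsmul_eq_mul]
    ring
  have hnonneg : 0 ≤ ∑ i : Fin n, ∑ j : Fin n, ∑ m : Fin n, h i j m ^ 2 := by positivity
  have hn' : (2 : ℝ) ≤ n := by exact_mod_cast hn
  have hpos : (0 : ℝ) < n * (n - 1) := mul_pos (by linarith) (by linarith)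
  have hneg : (c / 4) * (n * (n - 1)) < 0 := mul_neg_of_neg_of_pos (by linarith) hpos
  linarith
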